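/- Let k be an algebraically closed field of characteristic zero and let (K, δ_K) be an autonomous differential field over k such that the product differential field K * K has no new constants. Then for every autonomous differential field (L, δ_L) over k having no new constants, the product differential field K * L has no new constants. (This is the differential-field formulation of the paper's Theorem 1.1: if the cartesian square (X², v²) of an irreducible algebraic vector field (X, v) over k admits no nontrivial rational first integral, then for every irreducible algebraic vector field (Y, w) over k without nontrivial rational first integrals, the product (X × Y, v × w) admits no nontrivial rational first integral.) -/

import Mathlib

/-!
Differential-field formulation of Theorem 1.1 of the paper.

An *autonomous differential field* over an algebraically closed field `k` of
characteristic zero is a finitely generated field extension `K/k` together with a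
`k`-linear derivation `δ : K → K`.  It *has no new constants* if its constants are
exactly the image of `k`.  The *product differential field* `K * L` is the fraction
field of `K ⊗[k] L` with the unique derivation extending `δ_K` and `δ_L`; here it is
axiomatised (up to the canonical isomorphism) by a `ProductWitness`: a field `P`
together with `k`-algebra embeddings of `K` and `L` commuting with the derivations,
such that the induced map `K ⊗[k] L → P` is injective and every element of `P` is a
ratio of elements of its image.
-/

universe u

/-- An autonomous differential field over `k`: a finitely generated field extension of
`k` equipped with a `k`-linear derivation. -/
structure AutDiffField (k : Type u) [Field k] : Type (u + 1) where
  carrier : Type u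
  [isField : Field carrier]
  [isAlgebra : Algebra k carrier]
  fg : (⊤ : IntermediateField k carrier).FG
  deriv : Derivation k carrier carrier

attribute [instance] AutDiffField.isField AutDiffField.isAlgebra

/-- `A` has no new constants: its field of constants is exactly the image of `k`. -/
def AutDiffField.NoNewConstants {k : Type u} [Field k] (A : AutDiffField k) : Prop :=
  {x : A.carrier | A.deriv x = 0} = Set.range (algebraMap k A.carrier)

/-- A witness that `P` is the product differential field `A * B`, i.e. the fraction
field of `A ⊗[k] B` equipped with the unique derivation extending the derivations of
`A` and `B`. -/
structure ProductWitness {k : Type u} [Field k] (A B P : AutDiffField k) :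
    Type u where
  ιA : A.carrier →ₐ[k] P.carrier
  ιB : B.carrier →ₐ[k] P.carrier
  deriv_ιA : ∀ x : A.carrier, P.deriv (ιA x) = ιA (A.deriv x)
  deriv_ιB : ∀ y : B.carrier, P.deriv (ιB y) = ιB (B.deriv y)
  injective : Function.Injective (Algebra.TensorProduct.productMap ιA ιB)
  isFractionField : ∀ z : P.carrier, ∃ p q : TensorProduct k A.carrier B.carrier,
    q ≠ 0 ∧ z * (Algebra.TensorProduct.productMap ιA ιB) q =
      (Algebra.TensorProduct.productMap ιA ιB) p

open TensorProduct

namespace Derivation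

section TensorProduct

variable {k A B : Type*} [CommRing k] [CommRing A] [CommRing B] [Algebra k A] [Algebra k B]

/-- The derivation `d₁ ⊗ 1 + 1 ⊗ d₂` of a tensor product of algebras. -/
noncomputable def tensorProduct (d₁ : Derivation k A A) (d₂ : Derivation k B B) :
    Derivation k (A ⊗[k] B) (A ⊗[k] B) :=
  Derivation.mk' (d₁.toLinearMap.rTensor B + d₂.toLinearMap.lTensor A) <| by
    intro x y
    induction x with
    | zero => simp
    | add x₁ x₂ h₁ h₂ => rw [add_mul, map_add, h₁, h₂, map_add]; simp only [smul_eq_mul]; ring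
    | tmul a b =>
      induction y with
      | zero => simp
      | add y₁ y₂ h₁ h₂ => rw [mul_add, map_add, h₁, h₂, map_add]; simp only [smul_eq_mul]; ring
      | tmul a' b' =>
        simp only [Algebra.TensorProduct.tmul_mul_tmul, LinearMap.add_apply,
          LinearMap.rTensor_tmul, LinearMap.lTensor_tmul, smul_eq_mul, coeFn_coe, leibniz,
          add_tmul, tmul_add, mul_add, mul_comm]
        abel

@[simp]
lemma tensorProduct_tmul (d₁ : Derivation k A A) (d₂ : Derivation k B B) (a : A) (b : B) :
    tensorProduct d₁ d₂ (a ⊗ₜ b) = d₁ a ⊗ₜ b + a ⊗ₜ d₂ b := rfl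

/-- An algebra map out of a tensor product commutes with derivations as soon as it does so on
both factors. -/
lemma map_productMap {E : Type*} [CommRing E] [Algebra k E] (d₁ : Derivation k A A)
    (d₂ : Derivation k B B) (D : Derivation k E E) (f : A →ₐ[k] E) (g : B →ₐ[k] E)
    (hf : ∀ a, D (f a) = f (d₁ a)) (hg : ∀ b, D (g b) = g (d₂ b)) (x : A ⊗[k] B) :
    D (Algebra.TensorProduct.productMap f g x) =
      Algebra.TensorProduct.productMap f g (tensorProduct d₁ d₂ x) := by
  induction x with
  | zero => simp
  | add x y hx hy => simp only [map_add, hx, hy]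
  | tmul a b =>
    simp only [Algebra.TensorProduct.productMap_apply_tmul, leibniz, smul_eq_mul, hf, hg,
      tensorProduct_tmul, map_add]
    ring

end TensorProduct

/-- A derivation of a domain extends to its fraction field. -/
lemma exists_extension_fractionRing {k A : Type*} [CommRing k] [CommRing A] [IsDomain A]
    [Algebra k A] (d : Derivation k A A) :
    ∃ D : Derivation k (FractionRing A) (FractionRing A),
      ∀ a, D (algebraMap A _ a) = algebraMap A _ (d a) := by
  have : Algebra.FormallyEtale A (FractionRing A) :=
    Algebra.FormallyEtale.of_isLocalization (nonZeroDivisors A)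
  let e := KaehlerDifferential.tensorKaehlerEquivOfFormallyEtale k A (FractionRing A)
  let f : Ω[A⁄k] →ₗ[A] FractionRing A := (Algebra.linearMap A _).comp d.liftKaehlerDifferential
  refine ⟨((f.liftBaseChange (FractionRing A)).comp e.symm.toLinearMap).compDer
    (KaehlerDifferential.D k (FractionRing A)), fun a ↦ ?_⟩
  change f.liftBaseChange (FractionRing A) (e.symm (KaehlerDifferential.D k _ (algebraMap A _ a))) = _
  rw [KaehlerDifferential.tensorKaehlerEquivOfFormallyEtale_symm_D_algebraMap,
    LinearMap.liftBaseChange_tmul, one_smul]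
  exact congrArg (algebraMap A _) (d.liftKaehlerDifferential_comp_D a)

/-- Constants are linearly disjoint from a differential subring over the constants of its fraction
field. -/
lemma productMap_injective_of_constants {k A C E : Type*} [Field k] [CommRing A] [CommRing C]
    [CommRing E] [IsDomain E] [Algebra k A] [Algebra k C] [Algebra k E]
    (d : Derivation k A A) (D : Derivation k E E) (f : A →ₐ[k] E) (g : C →ₐ[k] E)
    (hf : ∀ a, D (f a) = f (d a)) (hg : ∀ c, D (g c) = 0)
    (hf_inj : Function.Injective f) (hg_inj : Function.Injective g)
    (hd : ∀ u v : A, v ≠ 0 → v * d u = u * d v → ∃ r : k, u = r • v) :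
    Function.Injective (Algebra.TensorProduct.productMap f g) := by
  let c := Module.Basis.ofVectorSpace k C
  have key : ∀ (s : Finset _) (u : _ → A), ∑ l ∈ s, f (u l) * g (c l) = 0 →
      ∀ l ∈ s, u l = 0 := by
    classical
    intro s
    induction s using Finset.induction_on with
    | empty => simp
    | insert i s hi ih =>
      intro u hu
      by_cases hui : u i = 0
      · rw [Finset.sum_insert hi, hui, map_zero, zero_mul, zero_add] at hu
        intro l hl
        rcases Finset.mem_insert.1 hl with rfl | hl
        · exact hui
        · exact ih u hu l hl
      exfalso
      have hDu : ∑ l ∈ insert i s, f (d (u l)) * g (c l) = 0 := by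
        rw [← map_zero D, ← hu, map_sum]
        refine Finset.sum_congr rfl fun l _ ↦ ?_
        rw [leibniz, hg, hf, smul_zero, zero_add, smul_eq_mul, mul_comm]
      have hw : ∑ l ∈ insert i s, f (u i * d (u l) - u l * d (u i)) * g (c l) = 0 := by
        calc _ = f (u i) * ∑ l ∈ insert i s, f (d (u l)) * g (c l) -
              f (d (u i)) * ∑ l ∈ insert i s, f (u l) * g (c l) := by
              rw [Finset.mul_sum, Finset.mul_sum, ← Finset.sum_sub_distrib]
              refine Finset.sum_congr rfl fun l _ ↦ ?_
              simp only [map_sub, map_mul]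
              ring
          _ = 0 := by rw [hDu, hu, mul_zero, mul_zero, sub_zero]
      rw [Finset.sum_insert hi, sub_self, map_zero, zero_mul, zero_add] at hw
      have hr : ∀ l ∈ insert i s, ∃ r : k, u l = r • u i := by
        intro l hl
        rcases Finset.mem_insert.1 hl with rfl | hl
        · exact ⟨1, (one_smul _ _).symm⟩
        · exact hd _ _ hui (sub_eq_zero.1 (ih _ hw l hl))
      choose! r hr using hr
      have hsum : f (u i) * g (∑ l ∈ insert i s, r l • c l) = 0 := by
        rw [← hu, map_sum, Finset.mul_sum]
        refine Finset.sum_congr rfl fun l hl ↦ ?_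
        rw [hr l hl, _root_.map_smul f, _root_.map_smul g, mul_smul_comm, smul_mul_assoc]
      have hc : ∑ l ∈ insert i s, r l • c l = 0 := by
        rcases mul_eq_zero.1 hsum with h | h
        · exact absurd ((map_eq_zero_iff f hf_inj).1 h) hui
        · exact (map_eq_zero_iff g hg_inj).1 h
      have hri := linearIndependent_iff'.1 c.linearIndependent _ _ hc i (Finset.mem_insert_self _ _)
      have := hr i (Finset.mem_insert_self _ _)
      rw [hri, zero_smul] at this
      exact hui this
  rw [injective_iff_map_eq_zero]
  intro x hx
  obtain ⟨b, rfl⟩ := TensorProduct.eq_repr_basis_right c x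
  simp only [Finsupp.sum, map_sum, Algebra.TensorProduct.productMap_apply_tmul] at hx
  refine Finset.sum_eq_zero fun l hl ↦ ?_
  simp only [key _ _ hx l hl, zero_tmul]

end Derivation

namespace PowerSeries

section

variable {k A : Type*} [CommRing k] [CommRing A] [Algebra k A]

/-- The derivation of a power series ring acting by `d` on the coefficients. -/
noncomputable def coeffDerivation (d : Derivation k A A) : Derivation k A⟦X⟧ A⟦X⟧ :=
  Derivation.mk'
    { toFun := fun f ↦ mk fun n ↦ d (coeff n f)
      map_add' := fun f g ↦ by ext; simp
      map_smul' := fun r f ↦ by ext; simp } <| by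
    intro f g
    ext n
    simp only [LinearMap.coe_mk, AddHom.coe_mk, coeff_mk, coeff_mul, map_sum, smul_eq_mul,
      map_add, Derivation.leibniz, Finset.sum_add_distrib]
    congr 1
    exact (Finset.sum_equiv (Equiv.prodComm ℕ ℕ) (by simp [add_comm]) (by simp))

@[simp]
lemma coeff_coeffDerivation (d : Derivation k A A) (f : A⟦X⟧) (n : ℕ) :
    coeff n (coeffDerivation d f) = d (coeff n f) :=
  coeff_mk n fun n ↦ d (coeff n f)

end

variable {k A : Type*} [Field k] [CommRing A] [Algebra k A]

/-- Uniqueness for the linear differential equation `∂F/∂t = d F + W F` in `A⟦t⟧`. -/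
lemma eq_zero_of_derivative_eq [CharZero k] (d : Derivation k A A) (F W : A⟦X⟧)
    (h : derivative A F = coeffDerivation d F + W * F) (h0 : constantCoeff F = 0) : F = 0 := by
  ext n
  induction n using Nat.strong_induction_on with
  | _ n ih =>
    cases n with
    | zero => simpa using h0
    | succ n =>
      have hn := congrArg (coeff n) h
      rw [coeff_derivative, map_add, coeff_coeffDerivation, ih n (Nat.lt_succ_self n), map_zero,
        map_zero, zero_add, coeff_mul, Finset.sum_eq_zero] at hn
      · have hu : IsUnit ((n : A) + 1) := by
          have := (IsUnit.mk0 ((n : k) + 1) (by exact_mod_cast n.succ_ne_zero)).map (algebraMap k A)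
          simpa using this
        simpa using (hu.mul_left_eq_zero).1 hn
      · intro p hp
        have := Finset.HasAntidiagonal.mem_antidiagonal.1 hp
        rw [ih p.2 (by omega), map_zero, mul_zero]

/-- The underlying function of the exponential `a ↦ ∑ dⁿ(a) tⁿ / n!`. -/
noncomputable def flowFun (d : Derivation k A A) (a : A) : A⟦X⟧ :=
  mk fun n ↦ ((n.factorial : k)⁻¹) • d^[n] a

lemma derivative_flowFun [CharZero k] (d : Derivation k A A) (a : A) :
    derivative A (flowFun d a) = flowFun d (d a) := by
  ext n
  rw [coeff_derivative, flowFun, flowFun, coeff_mk, coeff_mk, Function.iterate_succ_apply,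
    Nat.factorial_succ]
  have h : ((n : k) + 1) ≠ 0 := by exact_mod_cast n.succ_ne_zero
  have : ((n : A) + 1) = algebraMap k A ((n : k) + 1) := by simp
  rw [this, mul_comm, ← Algebra.smul_def, smul_smul]
  congr 1
  push_cast
  rw [mul_inv, mul_inv_cancel_left₀ h]

lemma coeffDerivation_flowFun (d : Derivation k A A) (a : A) :
    coeffDerivation d (flowFun d a) = flowFun d (d a) := by
  ext n
  simp only [coeff_coeffDerivation, flowFun, coeff_mk, d.map_smul]
  rw [← Function.iterate_succ_apply' d, Function.iterate_succ_apply]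

lemma constantCoeff_flowFun (d : Derivation k A A) (a : A) :
    constantCoeff (flowFun d a) = a := by
  rw [← coeff_zero_eq_constantCoeff_apply, flowFun, coeff_mk]
  simp

/-- The formal flow `a ↦ ∑ dⁿ(a) tⁿ / n!` of a derivation in characteristic zero. -/
noncomputable def flow [CharZero k] (d : Derivation k A A) : A →ₐ[k] A⟦X⟧ :=
  AlgHom.ofLinearMap
    { toFun := flowFun d
      map_add' := fun a b ↦ by ext; simp [flowFun, iterate_map_add]
      map_smul' := fun r a ↦ by
        ext n
        have : d^[n] (r • a) = r • d^[n] a := by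
          induction n with
          | zero => rfl
          | succ n ih => rw [Function.iterate_succ_apply', ih, d.map_smul,
              Function.iterate_succ_apply']
        simp only [flowFun, coeff_mk, this, RingHom.id_apply, coeff_smul]
        exact smul_comm _ _ _ }
    (by
      change flowFun d 1 = 1
      refine sub_eq_zero.1 (eq_zero_of_derivative_eq d _ 0 ?_ ?_)
      · rw [map_sub, map_sub, derivative_flowFun, coeffDerivation_flowFun]
        simp
      · simp [constantCoeff_flowFun])
    (by
      intro a b
      change flowFun d (a * b) = flowFun d a * flowFun d b
      refine sub_eq_zero.1 (eq_zero_of_derivative_eq d _ 0 ?_ ?_)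
      · simp only [map_sub, derivative_flowFun, coeffDerivation_flowFun, Derivation.leibniz]
        ring
      · simp [constantCoeff_flowFun])

lemma derivative_flow [CharZero k] (d : Derivation k A A) (a : A) :
    derivative A (flow d a) = flow d (d a) :=
  derivative_flowFun d a

lemma coeffDerivation_flow [CharZero k] (d : Derivation k A A) (a : A) :
    coeffDerivation d (flow d a) = flow d (d a) :=
  coeffDerivation_flowFun d a

lemma constantCoeff_flow [CharZero k] (d : Derivation k A A) (a : A) : constantCoeff (flow d a) = a :=
  constantCoeff_flowFun d a

end PowerSeries

/-- A derivation preserving a subalgebra restricts to it. -/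
def Derivation.restrictSubalgebra {k A : Type*} [CommRing k] [CommRing A] [Algebra k A]
    (d : Derivation k A A) (R : Subalgebra k A) (h : ∀ x ∈ R, d x ∈ R) : Derivation k R R :=
  Derivation.mk'
    { toFun := fun x ↦ ⟨d x, h x x.2⟩
      map_add' := fun x y ↦ Subtype.ext (map_add d (x : A) y)
      map_smul' := fun r x ↦ Subtype.ext (d.map_smul r (x : A)) }
    fun x y ↦ Subtype.ext (d.leibniz (x : A) y)

section Specialization

variable {k : Type*} [Field k]

/-- The weak Nullstellensatz: a nonzero finitely generated algebra over an algebraically closed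
field has a rational point. -/
lemma Algebra.FiniteType.nonempty_algHom [IsAlgClosed k] (R : Type*) [CommRing R] [Nontrivial R]
    [Algebra k R] [Algebra.FiniteType k R] : Nonempty (R →ₐ[k] k) := by
  obtain ⟨m, hm⟩ := Ideal.exists_maximal R
  let := Ideal.Quotient.field m
  have : Module.Finite k (R ⧸ m) := finite_of_finite_type_of_isJacobsonRing k (R ⧸ m)
  exact ⟨(IsAlgClosed.lift : (R ⧸ m) →ₐ[k] k).comp (Ideal.Quotient.mkₐ k m)⟩

/-- Finitely many elements of a finitely generated field extension with a derivation lie in a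
subalgebra which is stable under the derivation and has a rational point. -/
lemma Derivation.exists_stable_subalgebra_with_point [IsAlgClosed k] {L : Type*} [Field L]
    [Algebra k L] (hfg : (⊤ : IntermediateField k L).FG) (d : Derivation k L L) (F : Set L)
    (hF : F.Finite) :
    ∃ R : Subalgebra k L, F ⊆ R ∧ (∀ x ∈ R, d x ∈ R) ∧ Nonempty (R →ₐ[k] k) := by
  classical
  obtain ⟨S, hS⟩ := hfg
  let T : Finset L := S ∪ hF.toFinset
  let A₀ := Algebra.adjoin k (T : Set L)
  have hT : IntermediateField.adjoin k (T : Set L) = ⊤ := by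
    rw [eq_top_iff, ← hS]
    exact IntermediateField.adjoin.mono _ _ _ (by simp [T])
  have hfrac : ∀ x : L, ∃ n ∈ A₀, ∃ e ∈ A₀, e ≠ 0 ∧ x = n / e := by
    intro x
    have hx : x ∈ IntermediateField.adjoin k (T : Set L) := hT ▸ IntermediateField.mem_top
    obtain ⟨n, hn, e, he, rfl⟩ := IntermediateField.mem_adjoin_iff_div.1 hx
    by_cases h0 : e = 0
    · exact ⟨0, zero_mem _, 1, one_mem _, one_ne_zero, by simp [h0]⟩
    · exact ⟨n, hn, e, he, h0, rfl⟩
  choose n hn e he he0 hne using fun x ↦ hfrac (d x)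
  let s := ∏ x ∈ T, e x
  let R := Algebra.adjoin k (((insert s⁻¹ T : Finset L)) : Set L)
  have hs0 : s ≠ 0 := Finset.prod_ne_zero_iff.2 fun x _ ↦ he0 x
  have hTR : ∀ x ∈ insert s⁻¹ T, x ∈ R := fun x hx ↦ Algebra.subset_adjoin hx
  have hsR : s⁻¹ ∈ R := hTR _ (Finset.mem_insert_self _ _)
  have hA₀R : A₀ ≤ R := Algebra.adjoin_mono (by simp)
  have hdT : ∀ x ∈ T, d x ∈ R := by
    intro x hx
    have : d x = n x * (s⁻¹ * ∏ y ∈ T.erase x, e y) := by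
      have hmul : e x * ∏ y ∈ T.erase x, e y = s := Finset.mul_prod_erase T e hx
      rw [hne x, ← hmul]
      have := he0 x
      have : ∏ y ∈ T.erase x, e y ≠ 0 := Finset.prod_ne_zero_iff.2 fun y _ ↦ he0 y
      field_simp
    rw [this]
    exact mul_mem (hA₀R (hn x)) (mul_mem hsR (prod_mem fun y _ ↦ hA₀R (he y)))
  have hdA₀ : ∀ x ∈ A₀, d x ∈ R := by
    intro x hx
    induction hx using Algebra.adjoin_induction with
    | mem x hx => exact hdT x hx
    | algebraMap r => rw [d.map_algebraMap]; exact zero_mem _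
    | add x y _ _ h₁ h₂ => rw [map_add]; exact add_mem h₁ h₂
    | mul x y hx hy h₁ h₂ =>
      rw [d.leibniz, smul_eq_mul, smul_eq_mul]
      exact add_mem (mul_mem (hA₀R hx) h₂) (mul_mem (hA₀R hy) h₁)
  have hds : d s⁻¹ ∈ R := by
    rw [d.leibniz_inv, smul_eq_mul]
    exact mul_mem (neg_mem (pow_mem hsR 2)) (hdA₀ s (prod_mem fun y _ ↦ he y))
  have hfg : R.FG := Subalgebra.fg_adjoin_finset _
  have : Algebra.FiniteType k R := (Subalgebra.fg_iff_finiteType R).1 hfg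
  refine ⟨R, fun x hx ↦ hTR x (by simp [T, hx]), fun x hx ↦ ?_,
    Algebra.FiniteType.nonempty_algHom R⟩
  induction hx using Algebra.adjoin_induction with
  | mem x hx =>
    rcases Finset.mem_insert.1 (Finset.mem_coe.1 hx) with rfl | hx
    · exact hds
    · exact hdT x hx
  | algebraMap r => rw [d.map_algebraMap]; exact zero_mem _
  | add x y _ _ h₁ h₂ => rw [map_add]; exact add_mem h₁ h₂
  | mul x y hx hy h₁ h₂ =>
    rw [d.leibniz, smul_eq_mul, smul_eq_mul]
    exact add_mem (mul_mem hx h₂) (mul_mem hy h₁)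

/-- The specialization `A ⊗ R → A` at a rational point of `R`. -/
noncomputable def Algebra.TensorProduct.specialize {A R : Type*} [CommRing A] [Algebra k A]
    [CommRing R] [Algebra k R] (y : R →ₐ[k] k) : A ⊗[k] R →ₐ[k] A :=
  Algebra.TensorProduct.productMap (AlgHom.id k A) ((Algebra.ofId k A).comp y)

lemma Algebra.TensorProduct.specialize_tmul {A R : Type*} [CommRing A] [Algebra k A]
    [CommRing R] [Algebra k R] (y : R →ₐ[k] k) (a : A) (r : R) :
    specialize y (a ⊗ₜ r) = y r • a := by
  simp [specialize, Algebra.ofId_apply, Algebra.smul_def, mul_comm]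

/-- An element of `A ⊗ L` whose coordinates lie in a subalgebra `R` of `L` comes from `A ⊗ R`. -/
lemma TensorProduct.exists_lift_of_coord_mem {ι A L : Type*} [CommRing A] [Algebra k A]
    [CommRing L] [Algebra k L] (b : Module.Basis ι k A) (R : Subalgebra k L) (c : ι →₀ L)
    (hc : ∀ i, c i ∈ R) :
    ∃ x : A ⊗[k] R,
      Algebra.TensorProduct.map (AlgHom.id k A) R.val x = c.sum (fun i l ↦ b i ⊗ₜ[k] l) ∧
      ∀ (y : R →ₐ[k] k) (i : ι),
        b.repr (Algebra.TensorProduct.specialize y x) i = y ⟨c i, hc i⟩ := by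
  classical
  refine ⟨∑ i ∈ c.support, b i ⊗ₜ[k] (⟨c i, hc i⟩ : R), by simp [Finsupp.sum], fun y i ↦ ?_⟩
  have h0 : c i = 0 → y ⟨c i, hc i⟩ = 0 := fun h ↦ by
    rw [← map_zero y]
    exact congrArg y (Subtype.ext h)
  simp only [map_sum, Algebra.TensorProduct.specialize_tmul, map_smul, Module.Basis.repr_self,
    Finsupp.finsetSum_apply, Finsupp.smul_apply, Finsupp.single_apply, smul_eq_mul, mul_ite,
    mul_one, mul_zero, Finset.sum_ite_eq', Finsupp.mem_support_iff]
  split_ifs with h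
  · rfl
  · exact (h0 (not_not.1 h)).symm

/-- Over an algebraically closed field, the tensor product of two fields, one of them finitely
generated, is a domain. -/
lemma Algebra.TensorProduct.isDomain_of_isAlgClosed [IsAlgClosed k] {K L : Type*} [Field K]
    [Algebra k K] [Field L] [Algebra k L] (hfg : (⊤ : IntermediateField k L).FG) :
    IsDomain (K ⊗[k] L) := by
  refine @NoZeroDivisors.to_isDomain _ _ inferInstance ⟨fun {u v} huv ↦ ?_⟩
  by_contra! h
  let b := Module.Basis.ofVectorSpace k K
  obtain ⟨c, rfl⟩ := TensorProduct.eq_repr_basis_left b u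
  obtain ⟨e, rfl⟩ := TensorProduct.eq_repr_basis_left b v
  obtain ⟨i, hi⟩ : ∃ i, c i ≠ 0 := by
    by_contra! h0
    exact h.1 (by rw [Finsupp.ext (g := 0) h0, Finsupp.sum_zero_index])
  obtain ⟨j, hj⟩ : ∃ j, e j ≠ 0 := by
    by_contra! h0
    exact h.2 (by rw [Finsupp.ext (g := 0) h0, Finsupp.sum_zero_index])
  obtain ⟨R, hR, -, ⟨y⟩⟩ := Derivation.exists_stable_subalgebra_with_point hfg 0
    (Set.range c ∪ Set.range e ∪ {(c i)⁻¹, (e j)⁻¹})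
    ((c.finite_range.union e.finite_range).union (Set.toFinite _))
  have hc : ∀ i, c i ∈ R := fun i ↦ hR (by simp)
  have he : ∀ i, e i ∈ R := fun i ↦ hR (by simp)
  have hyne : ∀ (x : L) (hx : x ∈ R), x⁻¹ ∈ R → x ≠ 0 → y ⟨x, hx⟩ ≠ 0 := by
    intro x hx hx' h0 hy
    have : y (⟨x, hx⟩ * ⟨x⁻¹, hx'⟩) = 1 := by
      rw [← map_one y]
      exact congrArg y (Subtype.ext (mul_inv_cancel₀ h0))
    rw [map_mul, hy, zero_mul] at this
    exact zero_ne_one this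
  obtain ⟨u, hu, hu'⟩ := TensorProduct.exists_lift_of_coord_mem b R c hc
  obtain ⟨v, hv, hv'⟩ := TensorProduct.exists_lift_of_coord_mem b R e he
  have huv' : u * v = 0 := by
    apply Module.Flat.lTensor_preserves_injective_linearMap (M := K) R.val.toLinearMap
      Subtype.val_injective
    change Algebra.TensorProduct.map (AlgHom.id k K) R.val (u * v) = _
    rw [map_mul, hu, hv, huv, map_zero]
  have hs : specialize y u * specialize y v = 0 := by rw [← map_mul, huv', map_zero]
  rcases mul_eq_zero.1 hs with h0 | h0
  · refine hyne (c i) (hc i) (hR (by simp)) hi ?_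
    rw [← hu', h0, map_zero, Finsupp.zero_apply]
  · refine hyne (e j) (he j) (hR (by simp)) hj ?_
    rw [← hv', h0, map_zero, Finsupp.zero_apply]

end Specialization

open PowerSeries in
/-- Let `K` be a differential field such that the fraction field of `K ⊗ K` has constants `k`.
If the quotient of `p` and `q` in `K ⊗ R` is constant, then its specialization at any rational
point of `R` where `q` does not vanish lies in `k`. -/
lemma Derivation.specialize_eq_smul_of_constant {k K R : Type*} [Field k] [CharZero k] [Field K]
    [Algebra k K] [CommRing R] [Algebra k R] (dK : Derivation k K K) (dR : Derivation k R R)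
    (hK : ∀ a, dK a = 0 → ∃ r, algebraMap k K r = a)
    (hKK : ∀ u v : K ⊗[k] K, v ≠ 0 → v * tensorProduct dK dK u = u * tensorProduct dK dK v →
      ∃ r : k, u = r • v)
    (y : R →ₐ[k] k) (p q : K ⊗[k] R)
    (hpq : tensorProduct dK dR p * q = p * tensorProduct dK dR q)
    (hq : Algebra.TensorProduct.specialize y q ≠ 0) :
    ∃ r : k, Algebra.TensorProduct.specialize y p = r • Algebra.TensorProduct.specialize y q := by
  let γ : K →ₐ[k] K⟦X⟧ := IsScalarTower.toAlgHom k K K⟦X⟧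
  let ι : k⟦X⟧ →ₐ[k] K⟦X⟧ := mapAlgHom (Algebra.ofId k K)
  let τ : R →ₐ[k] k⟦X⟧ := (mapAlgHom y).comp (flow (-dR))
  let Φ : K ⊗[k] K →ₐ[k] K⟦X⟧ := Algebra.TensorProduct.productMap γ (flow dK)
  let Θ : K ⊗[k] R →ₐ[k] K⟦X⟧ := Algebra.TensorProduct.productMap γ (ι.comp τ)
  let D : Derivation k K⟦X⟧ K⟦X⟧ := coeffDerivation dK - (derivative K).restrictScalars k
  have hD : ∀ f, D f = coeffDerivation dK f - derivative K f := fun _ ↦ rfl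
  have hγ : ∀ a, γ a = C a := fun _ ↦ rfl
  have hcγ : ∀ a, coeffDerivation dK (γ a) = γ (dK a) := by
    intro a
    ext n
    simp only [hγ, coeff_coeffDerivation, coeff_C]
    split_ifs <;> simp
  have hDγ : ∀ a, D (γ a) = γ (dK a) := by
    intro a
    rw [hD, hcγ, hγ a, derivative_C, sub_zero]
  have hcι : ∀ c, coeffDerivation dK (ι c) = 0 := by
    intro c
    ext n
    simp [ι, mapAlgHom_apply]
  have hDτ : ∀ r, D (ι.comp τ r) = ι.comp τ (dR r) := by
    intro r
    have h₁ : derivative K (ι (τ r)) = ι (mapAlgHom y (derivative R (flow (-dR) r))) := by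
      ext n
      simp [ι, τ, mapAlgHom_apply, coeff_derivative]
    rw [hD, AlgHom.comp_apply, hcι, h₁, derivative_flow, Derivation.neg_apply, map_neg, map_neg,
      map_neg, zero_sub, neg_neg]
    rfl
  have hγ_inj : Function.Injective γ := γ.toRingHom.injective
  have hι_inj : Function.Injective ι := by
    intro f g h
    ext n
    have := congrArg (coeff n) h
    simpa [ι, mapAlgHom_apply, Algebra.ofId_apply] using this
  have hflow_inj : Function.Injective (flow dK) := (flow dK).toRingHom.injective
  have hΦ_inj : Function.Injective Φ := by
    refine productMap_injective_of_constants dK D γ (flow dK) hDγ (fun c ↦ ?_) hγ_inj hflow_inj ?_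
    · rw [hD, coeffDerivation_flow, derivative_flow, sub_self]
    · intro u v hv huv
      have hdiv : dK (u / v) = 0 := by
        rw [Derivation.leibniz_div]
        simp [huv]
      obtain ⟨r, hr⟩ := hK _ hdiv
      exact ⟨r, by rw [Algebra.smul_def, hr, div_mul_cancel₀ _ hv]⟩
  have hΨ_inj : Function.Injective (Algebra.TensorProduct.productMap Φ ι) :=
    productMap_injective_of_constants (tensorProduct dK dK) (coeffDerivation dK) Φ ι
      (map_productMap dK dK (coeffDerivation dK) γ (flow dK) hcγ (coeffDerivation_flow dK)) hcι
      hΦ_inj hι_inj hKK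
  have hτ : ∀ r, constantCoeff (ι (τ r)) = algebraMap k K (y r) := by
    intro r
    have h₀ : coeff 0 (flow (-dR) r) = r := by
      rw [coeff_zero_eq_constantCoeff_apply, constantCoeff_flow]
    rw [← coeff_zero_eq_constantCoeff_apply]
    simp only [ι, τ, AlgHom.comp_apply, mapAlgHom_apply, coeff_map, h₀]
    rfl
  have hΘ_zero : ∀ x, constantCoeff (Θ x) = Algebra.TensorProduct.specialize y x := by
    intro x
    induction x with
    | zero => simp
    | add x y hx hy => simp only [map_add, hx, hy]
    | tmul a r =>
      rw [Algebra.TensorProduct.specialize_tmul]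
      simp [Θ, hγ, hτ, Algebra.smul_def, mul_comm]
  have hΘD := map_productMap dK dR D γ (ι.comp τ) hDγ hDτ
  have hΘq : constantCoeff (Θ q) ≠ 0 := by rwa [hΘ_zero]
  let g := Algebra.TensorProduct.specialize y p / Algebra.TensorProduct.specialize y q
  have hflow : Θ p = flow dK g * Θ q := by
    refine sub_eq_zero.1 (eq_zero_of_derivative_eq dK _ (-(D (Θ q) * (Θ q)⁻¹)) ?_ ?_)
    · have hΘ : D (Θ p) * Θ q = Θ p * D (Θ q) := by
        rw [hΘD p, hΘD q]
        exact (map_mul Θ _ _).symm.trans ((congrArg Θ hpq).trans (map_mul Θ _ _))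
      have hDg : D (flow dK g) = 0 := by
        rw [hD, coeffDerivation_flow, derivative_flow, sub_self]
      have hinv : (Θ q)⁻¹ * Θ q = 1 := PowerSeries.inv_mul_cancel _ hΘq
      have hDF : D (Θ p - flow dK g * Θ q) =
          D (Θ q) * (Θ q)⁻¹ * (Θ p - flow dK g * Θ q) := by
        rw [map_sub, leibniz, hDg, smul_zero, add_zero, smul_eq_mul]
        linear_combination (Θ q)⁻¹ * hΘ + (flow dK g * D (Θ q) - D (Θ p)) * hinv
      rw [hD] at hDF
      linear_combination -hDF
    · rw [map_sub, map_mul, constantCoeff_flow, hΘ_zero, hΘ_zero, div_mul_cancel₀ _ hq, sub_self]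
  by_cases hg : g ∈ Submodule.span k {(1 : K)}
  · obtain ⟨r, hr⟩ := Submodule.mem_span_singleton.1 hg
    refine ⟨r, ?_⟩
    rw [← div_mul_cancel₀ (Algebra.TensorProduct.specialize y p) hq]
    change g * _ = _
    rw [← hr, smul_mul_assoc, one_mul]
  exfalso
  obtain ⟨φ, hφg, hφ⟩ := Submodule.exists_le_ker_of_notMem hg
  have hφ1 : φ 1 = 0 := hφ (Submodule.mem_span_singleton_self 1)
  let j : K ⊗[k] k⟦X⟧ →ₐ[k] (K ⊗[k] K) ⊗[k] k⟦X⟧ :=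
    Algebra.TensorProduct.map Algebra.TensorProduct.includeLeft (AlgHom.id k _)
  let σ : K ⊗[k] R →ₐ[k] K ⊗[k] k⟦X⟧ := Algebra.TensorProduct.map (AlgHom.id k K) τ
  have hjσ : ∀ x, Algebra.TensorProduct.productMap Φ ι (j (σ x)) = Θ x := by
    intro x
    induction x with
    | zero => simp
    | add x y hx hy => simp only [map_add, hx, hy]
    | tmul a r => simp [j, σ, Θ, Φ]
  have hj : j (σ p) = ((1 ⊗ₜ g) ⊗ₜ 1) * j (σ q) := by
    apply hΨ_inj
    rw [map_mul, hjσ, hjσ, hflow]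
    simp [Φ]
  let T : (K ⊗[k] K) ⊗[k] k⟦X⟧ →ₗ[k] K ⊗[k] k⟦X⟧ :=
    ((TensorProduct.rid k K).toLinearMap ∘ₗ φ.lTensor K).rTensor _
  have hT : ∀ (a : K) x, T (((1 ⊗ₜ a) ⊗ₜ 1) * j x) = φ a • x := by
    intro a x
    induction x with
    | zero => simp
    | add x y hx hy => simp only [map_add, mul_add, hx, hy, smul_add]
    | tmul b c => simp [T, j, smul_tmul']
  have h₁ : T (j (σ p)) = 0 := by
    have := hT 1 (σ p)
    rwa [hφ1, zero_smul, ← Algebra.TensorProduct.one_def, ← Algebra.TensorProduct.one_def,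
      one_mul] at this
  rw [hj, hT] at h₁
  have hσq : σ q = 0 := (smul_eq_zero.1 h₁).resolve_left hφg
  rw [← hjσ q, hσq, map_zero, map_zero, map_zero] at hΘq
  exact hΘq rfl

/-- The fraction field of `A ⊗ B` is a product differential field. -/
lemma AutDiffField.exists_productWitness {k : Type u} [Field k] [IsAlgClosed k]
    (A B : AutDiffField k) : ∃ P : AutDiffField k, Nonempty (ProductWitness A B P) := by
  have := Algebra.TensorProduct.isDomain_of_isAlgClosed (K := A.carrier) B.fg
  obtain ⟨D, hD⟩ := Derivation.exists_extension_fractionRing (A.deriv.tensorProduct B.deriv)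
  let F := FractionRing (A.carrier ⊗[k] B.carrier)
  have hA : Algebra.EssFiniteType k A.carrier := IntermediateField.fg_top_iff.1 A.fg
  have hB : Algebra.EssFiniteType k B.carrier := IntermediateField.fg_top_iff.1 B.fg
  have hF : Algebra.EssFiniteType (A.carrier ⊗[k] B.carrier) F :=
    Algebra.EssFiniteType.of_isLocalization F (nonZeroDivisors _)
  have hAB : Algebra.EssFiniteType k (A.carrier ⊗[k] B.carrier) :=
    Algebra.EssFiniteType.comp k A.carrier _
  have hkF : Algebra.EssFiniteType k F :=
    Algebra.EssFiniteType.comp k (A.carrier ⊗[k] B.carrier) F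
  let i : A.carrier ⊗[k] B.carrier →ₐ[k] F := IsScalarTower.toAlgHom k _ F
  have hi : Algebra.TensorProduct.productMap
      (i.comp Algebra.TensorProduct.includeLeft) (i.comp Algebra.TensorProduct.includeRight) =
        i := by
    ext x
    · simp
    · simp [← map_mul]
  refine ⟨⟨F, IntermediateField.fg_top_iff.2 hkF, D⟩,
    ⟨⟨i.comp Algebra.TensorProduct.includeLeft, i.comp Algebra.TensorProduct.includeRight,
      fun x ↦ ?_, fun x ↦ ?_, ?_, fun z ↦ ?_⟩⟩⟩
  · exact (hD _).trans (by simp [i]; rfl)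
  · exact (hD _).trans (by simp [i]; rfl)
  · rw [hi]
    exact IsFractionRing.injective _ F
  · obtain ⟨p, q, hq, rfl⟩ := IsFractionRing.div_surjective (A := A.carrier ⊗[k] B.carrier) z
    refine ⟨p, q, nonZeroDivisors.ne_zero hq, ?_⟩
    rw [hi]
    exact div_mul_cancel₀ _ (IsFractionRing.to_map_ne_zero_of_mem_nonZeroDivisors hq)

/-- If `A * B` has no new constants, two elements of `A ⊗ B` with constant quotient are
proportional over `k`. -/
lemma ProductWitness.eq_smul_of_constant {k : Type u} [Field k] {A B P : AutDiffField k}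
    (W : ProductWitness A B P) (hP : P.NoNewConstants) (u v : A.carrier ⊗[k] B.carrier)
    (hv : v ≠ 0)
    (h : v * A.deriv.tensorProduct B.deriv u = u * A.deriv.tensorProduct B.deriv v) :
    ∃ r : k, u = r • v := by
  set m := Algebra.TensorProduct.productMap W.ιA W.ιB with hm
  have hmD := Derivation.map_productMap A.deriv B.deriv P.deriv W.ιA W.ιB W.deriv_ιA W.deriv_ιB
  have hmv : m v ≠ 0 := (map_ne_zero_iff m W.injective).2 hv
  have hc : P.deriv (m u / m v) = 0 := by
    rw [Derivation.leibniz_div, hm, hmD, hmD, ← hm, smul_eq_mul, smul_eq_mul, ← map_mul, h,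
      map_mul, smul_eq_mul, sub_self, mul_zero]
  obtain ⟨r, hr⟩ := hP.subset hc
  refine ⟨r, W.injective ?_⟩
  change m u = m (r • v)
  rw [map_smul, Algebra.smul_def, hr, div_mul_cancel₀ _ hmv]

/-- **Theorem 1.1** (differential-field formulation).  If `K * K` has no new
constants, then `K * L` has no new constants for every autonomous differential field
`L` over `k` having no new constants. -/
theorem product_no_new_constants
    {k : Type u} [Field k] [IsAlgClosed k] [CharZero k]
    (K : AutDiffField k)
    (hK : ∀ P : AutDiffField k, Nonempty (ProductWitness K K P) → P.NoNewConstants)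
    (L : AutDiffField k) (hL : L.NoNewConstants)
    (P : AutDiffField k) (hP : Nonempty (ProductWitness K L P)) :
    P.NoNewConstants := by
  obtain ⟨Q, ⟨V⟩⟩ := K.exists_productWitness K
  have hKK := V.eq_smul_of_constant (hK Q ⟨V⟩)
  have hK₀ : ∀ a, K.deriv a = 0 → ∃ r, algebraMap k K.carrier r = a := by
    intro a ha
    have h : Q.deriv (V.ιA a) = 0 := by rw [V.deriv_ιA, ha, map_zero]
    obtain ⟨r, hr⟩ := (hK Q ⟨V⟩).subset h
    exact ⟨r, V.ιA.toRingHom.injective ((V.ιA.commutes r).trans hr)⟩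
  obtain ⟨W⟩ := hP
  refine Set.Subset.antisymm (fun z hz ↦ ?_) ?_
  swap
  · rintro _ ⟨r, rfl⟩
    exact P.deriv.map_algebraMap r
  obtain ⟨p, q, hq, hpq⟩ := W.isFractionField z
  set m := Algebra.TensorProduct.productMap W.ιA W.ιB with hm
  have hmD := Derivation.map_productMap K.deriv L.deriv P.deriv W.ιA W.ιB W.deriv_ιA W.deriv_ιB
  have hmq : m q ≠ 0 := (map_ne_zero_iff m W.injective).2 hq
  have hDpq : K.deriv.tensorProduct L.deriv p * q = p * K.deriv.tensorProduct L.deriv q := by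
    apply W.injective
    change m _ = m _
    have h : P.deriv (z * m q) = z * P.deriv (m q) := by
      rw [P.deriv.leibniz, show P.deriv z = 0 from hz, smul_zero, add_zero, smul_eq_mul]
    rw [hpq, hm, hmD, hmD, ← hm] at h
    rw [map_mul, map_mul, h, ← hpq]
    ring
  let b := Module.Basis.ofVectorSpace k K.carrier
  obtain ⟨c, rfl⟩ := TensorProduct.eq_repr_basis_left b p
  obtain ⟨e, rfl⟩ := TensorProduct.eq_repr_basis_left b q
  obtain ⟨j, hj⟩ : ∃ j, e j ≠ 0 := by
    by_contra! h0
    exact hq (by rw [Finsupp.ext (g := 0) h0, Finsupp.sum_zero_index])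
  by_cases hprop : ∀ i, c i * e j = c j * e i
  · have hce : c = (c j / e j) • e := by
      ext i
      rw [Finsupp.smul_apply, smul_eq_mul, div_mul_eq_mul_div, ← hprop, mul_div_cancel_right₀ _ hj]
    have hz' : z = W.ιB (c j / e j) := by
      apply mul_right_cancel₀ hmq
      rw [hpq]
      conv_lhs => rw [hce]
      rw [Finsupp.sum_smul_index (by simp), Finsupp.sum, Finsupp.sum, map_sum, map_sum,
        Finset.mul_sum]
      refine Finset.sum_congr rfl fun i _ ↦ ?_
      simp only [hm, Algebra.TensorProduct.productMap_apply_tmul, map_mul]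
      ring
    have hd : L.deriv (c j / e j) = 0 := by
      apply W.ιB.toRingHom.injective
      change W.ιB _ = W.ιB 0
      rw [← W.deriv_ιB, ← hz', map_zero]
      exact hz
    obtain ⟨r, hr⟩ := hL.subset hd
    exact ⟨r, by rw [hz', ← hr, AlgHom.commutes]⟩
  exfalso
  push Not at hprop
  obtain ⟨i, hi⟩ := hprop
  have hne : c i * e j - c j * e i ≠ 0 := sub_ne_zero.2 hi
  obtain ⟨R, hR, hdR, ⟨y⟩⟩ := L.deriv.exists_stable_subalgebra_with_point L.fg
    (Set.range c ∪ Set.range e ∪ {(c i * e j - c j * e i)⁻¹})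
    ((c.finite_range.union e.finite_range).union (Set.toFinite _))
  have hc : ∀ i, c i ∈ R := fun i ↦ hR (by simp)
  have he : ∀ i, e i ∈ R := fun i ↦ hR (by simp)
  have hminor : y ⟨c i, hc i⟩ * y ⟨e j, he j⟩ - y ⟨c j, hc j⟩ * y ⟨e i, he i⟩ ≠ 0 := by
    rw [← map_mul, ← map_mul, ← map_sub]
    intro h0
    have : y ((⟨c i, hc i⟩ * ⟨e j, he j⟩ - ⟨c j, hc j⟩ * ⟨e i, he i⟩) *
        ⟨(c i * e j - c j * e i)⁻¹, hR (by simp)⟩) = 1 := by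
      rw [← map_one y]
      exact congrArg y (Subtype.ext (mul_inv_cancel₀ hne))
    rw [map_mul, h0, zero_mul] at this
    exact zero_ne_one this
  obtain ⟨p, hp, hpy⟩ := TensorProduct.exists_lift_of_coord_mem b R c hc
  obtain ⟨q, hq', hqy⟩ := TensorProduct.exists_lift_of_coord_mem b R e he
  let dR := L.deriv.restrictSubalgebra R hdR
  let ρ := Algebra.TensorProduct.map (AlgHom.id k K.carrier) R.val
  have hρ : Function.Injective ρ :=
    Module.Flat.lTensor_preserves_injective_linearMap (M := K.carrier) R.val.toLinearMap
      Subtype.val_injective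
  have hρD : ∀ x, ρ (K.deriv.tensorProduct dR x) = K.deriv.tensorProduct L.deriv (ρ x) := by
    intro x
    induction x with
    | zero => simp
    | add x y hx hy => simp only [map_add, hx, hy]
    | tmul a r =>
      simp [ρ]
      rfl
  have hpqR : K.deriv.tensorProduct dR p * q = p * K.deriv.tensorProduct dR q := by
    apply hρ
    rw [map_mul, map_mul, hρD, hρD]
    simp only [ρ, hp, hq', hDpq]
  have hq₀ : Algebra.TensorProduct.specialize y q ≠ 0 := by
    intro h0
    apply hminor
    rw [← hqy y i, ← hqy y j, h0]
    simp
  obtain ⟨r, hr⟩ := Derivation.specialize_eq_smul_of_constant K.deriv dR hK₀ hKK y p q hpqR hq₀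
  apply hminor
  rw [← hqy y i, ← hqy y j, ← hpy y i, ← hpy y j, hr, map_smul, Finsupp.smul_apply,
    Finsupp.smul_apply, smul_eq_mul, smul_eq_mul]
  ring
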